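/- Let k ≥ 3 be an integer, N ≥ 4 an integer, and 0 < δ < 1/4. Let f be of class C^k on [N, 2N] such that there exist λ_k > 0 and c_k ≥ 1 with λ_k ≤ |f^{(k)}(x)| ≤ c_k·λ_k on [N, 2N]. Let N ≤ n₀ < n₁ < ⋯ < n_k ≤ 2N be k+1 integers belonging to S(f,N,δ) such that the k+1 points (n_j, ⌊f(n_j)⌉), where ⌊x⌉ denotes the nearest integer to x, do not all lie on the graph of a single polynomial of degree < k. Then n_k − n₀ > min( (c_k·λ_k)^{−2/(k(k+1))}, (1/2)·δ^{−2/(k(k−1))} ). -/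

import Mathlib

open Polynomial in
theorem Polynomial.iteratedDeriv_eval (P : ℝ[X]) (m : ℕ) :
    iteratedDeriv m (fun x => P.eval x) = fun x => (derivative^[m] P).eval x := by
  induction m with
  | zero => simp
  | succ m ih =>
    rw [iteratedDeriv_succ, ih, Function.iterate_succ']
    ext x
    simp

open Polynomial in
theorem Polynomial.iteratedDeriv_eval_of_natDegree_le {P : ℝ[X]} {k : ℕ} (hP : P.natDegree ≤ k)
    (x : ℝ) : iteratedDeriv k (fun x => P.eval x) x = k.factorial * P.coeff k := by
  have hdeg : (derivative^[k] P).natDegree = 0 := by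
    have := P.natDegree_iterate_derivative k
    omega
  rw [P.iteratedDeriv_eval k]
  beta_reduce
  rw [eq_C_of_natDegree_eq_zero hdeg, eval_C, coeff_iterate_derivative]
  simp [Nat.descFactorial_self]

/-- Generalized Rolle theorem: a function with `m + 1` zeros has an `m`-th derivative with
a zero. -/
theorem exists_iteratedDerivWithin_eq_zero {a b : ℝ} (hab : a < b) (m : ℕ) (g : ℝ → ℝ)
    (hg : ContDiffOn ℝ m g (Set.Icc a b)) (x : Fin (m + 1) → ℝ) (hx : StrictMono x)
    (hmem : ∀ i, x i ∈ Set.Icc a b) (h0 : ∀ i, g (x i) = 0) :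
    ∃ ξ ∈ Set.Icc a b, iteratedDerivWithin m g (Set.Icc a b) ξ = 0 := by
  induction m generalizing g with
  | zero => exact ⟨x 0, hmem 0, by simpa using h0 0⟩
  | succ m ih =>
    have hu : UniqueDiffOn ℝ (Set.Icc a b) := uniqueDiffOn_Icc hab
    have hzero : ∀ i : Fin (m + 1), ∃ y ∈ Set.Ioo (x i.castSucc) (x i.succ),
        derivWithin g (Set.Icc a b) y = 0 := by
      intro i
      have hlt : x i.castSucc < x i.succ := hx i.castSucc_lt_succ
      have hsub : Set.Icc (x i.castSucc) (x i.succ) ⊆ Set.Icc a b :=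
        Set.Icc_subset_Icc (hmem _).1 (hmem _).2
      obtain ⟨y, hy, hy0⟩ := exists_deriv_eq_zero hlt (hg.continuousOn.mono hsub)
        (by rw [h0, h0])
      refine ⟨y, hy, ?_⟩
      rw [derivWithin_of_mem_nhds, hy0]
      exact Icc_mem_nhds ((hmem _).1.trans_lt hy.1) (hy.2.trans_le (hmem _).2)
    choose y hy hy0 using hzero
    rw [iteratedDerivWithin_succ']
    refine ih _ (hg.derivWithin hu (by norm_cast)) y ?_ ?_ hy0
    · refine Fin.strictMono_iff_lt_succ.2 fun i => ?_
      exact (hy _).2.trans (hy i.succ).1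
    · exact fun i => ⟨(hmem _).1.trans (hy i).1.le, (hy i).2.le.trans (hmem _).2⟩

/-- Mean value theorem for divided differences, in terms of the leading coefficient of the
interpolating polynomial. -/
theorem exists_iteratedDerivWithin_eq_factorial_mul_coeff {a b : ℝ} (hab : a < b) {k : ℕ}
    {f : ℝ → ℝ} (hf : ContDiffOn ℝ k f (Set.Icc a b)) {x : Fin (k + 1) → ℝ} (hx : StrictMono x)
    (hmem : ∀ i, x i ∈ Set.Icc a b) {P : Polynomial ℝ} (hP : P.natDegree ≤ k)
    (heval : ∀ i, P.eval (x i) = f (x i)) :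
    ∃ ξ ∈ Set.Icc a b,
      iteratedDerivWithin k f (Set.Icc a b) ξ = k.factorial * P.coeff k := by
  have hPc : ContDiff ℝ k (fun x => P.eval x) := by
    simpa using P.contDiff_aeval (𝕜 := ℝ) k
  obtain ⟨ξ, hξ, h⟩ := exists_iteratedDerivWithin_eq_zero hab k (f - fun x => P.eval x)
    (hf.sub hPc.contDiffOn) x hx hmem (fun i => by simp [heval])
  refine ⟨ξ, hξ, ?_⟩
  rw [iteratedDerivWithin_sub hξ (uniqueDiffOn_Icc hab) (hf ξ hξ) hPc.contDiffAt.contDiffWithinAt,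
    iteratedDerivWithin_eq_iteratedDeriv (uniqueDiffOn_Icc hab) hPc.contDiffAt hξ,
    Polynomial.iteratedDeriv_eval_of_natDegree_le hP] at h
  linarith

open Matrix in
theorem Matrix.cramer_vandermonde_eval_last {R : Type*} [CommRing R] {k : ℕ} (v : Fin (k + 1) → R)
    {P : Polynomial R} (hP : P.natDegree ≤ k) :
    cramer (vandermonde v) (fun j => P.eval (v j)) (Fin.last k) =
      (vandermonde v).det * P.coeff k := by
  have h : (fun j => P.eval (v j)) = vandermonde v *ᵥ fun a : Fin (k + 1) => P.coeff a := by
    ext j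
    rw [Polynomial.eval_eq_sum_range' (Nat.lt_succ_of_le hP), Finset.sum_range]
    simp [mulVec, dotProduct, vandermonde_apply, mul_comm]
  rw [h, cramer_eq_adjugate_mulVec, mulVec_mulVec, adjugate_mul]
  simp [smul_mulVec]

theorem Matrix.cramer_vandermonde_last {R : Type*} [CommRing R] {k : ℕ} (v b : Fin (k + 1) → R) :
    cramer (vandermonde v) b (Fin.last k) =
      ∑ j : Fin (k + 1), (-1) ^ (j + k : ℕ) * b j * (vandermonde (v ∘ j.succAbove)).det := by
  rw [cramer_apply, det_succ_column _ (Fin.last k)]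
  refine Finset.sum_congr rfl fun j _ => ?_
  congr 1
  · simp
  · congr 1
    ext i a
    simp [vandermonde_apply, (Fin.castSucc_lt_last a).ne]

theorem Matrix.abs_det_vandermonde_le {m : ℕ} (v : Fin m → ℝ) {L : ℝ}
    (hv : ∀ i j, |v i - v j| ≤ L) : |(vandermonde v).det| ≤ L ^ (m.choose 2) := by
  rw [det_vandermonde, Finset.abs_prod]
  have hrow : ∀ i : Fin m, |∏ j ∈ Finset.Ioi i, (v j - v i)| ≤ L ^ (m - 1 - i : ℕ) := by
    intro i
    rw [Finset.abs_prod, ← Fin.card_Ioi, ← Finset.prod_const]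
    exact Finset.prod_le_prod (fun _ _ => abs_nonneg _) fun j _ => hv j i
  refine (Finset.prod_le_prod (fun _ _ => abs_nonneg _) fun i _ => hrow i).trans_eq ?_
  rw [Finset.prod_pow_eq_pow_sum, Fin.sum_univ_eq_sum_range (fun i => m - 1 - i),
    Finset.sum_range_reflect (fun i => i), Finset.sum_range_id, Nat.choose_two_right]

theorem pow_le_inv_of_le_rpow_neg {x y s : ℝ} {m : ℕ} (hx : 0 ≤ x) (hy : 0 < y)
    (hs : s * m = 1) (h : x ≤ y ^ (-s)) : x ^ m ≤ y⁻¹ := by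
  calc x ^ m ≤ (y ^ (-s)) ^ m := pow_le_pow_left₀ hx h m
    _ = y⁻¹ := by
      rw [← Real.rpow_natCast, ← Real.rpow_mul hy.le, neg_mul, hs, Real.rpow_neg_one]

theorem two_mul_succ_le_two_pow_choose_two {k : ℕ} (hk : 3 ≤ k) :
    2 * (k + 1) ≤ 2 ^ (k.choose 2) := by
  induction k, hk using Nat.le_induction with
  | base => decide
  | succ k hk ih =>
    have hchoose : (k + 1).choose 2 = k + k.choose 2 := by
      rw [Nat.choose_succ_succ' k 1, Nat.choose_one_right]
    have hpow : 2 ^ 1 ≤ 2 ^ k := Nat.pow_le_pow_right (by norm_num) (by omega)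
    rw [hchoose, pow_add]
    nlinarith

theorem exists_natDegree_le_forall_eval_eq {F : Type*} [Field F] {k : ℕ} {v : Fin (k + 1) → F}
    (hv : Function.Injective v) (r : Fin (k + 1) → F) :
    ∃ P : Polynomial F, P.natDegree ≤ k ∧ ∀ j, P.eval (v j) = r j := by
  refine ⟨Lagrange.interpolate Finset.univ v r, Polynomial.natDegree_le_of_degree_le ?_,
    fun j => Lagrange.eval_interpolate_at_node r hv.injOn (Finset.mem_univ j)⟩
  have h := Lagrange.degree_interpolate_le (s := Finset.univ) r hv.injOn
  rwa [Finset.card_univ, Fintype.card_fin, Nat.add_sub_cancel] at h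

/-- The integer determinant `cramer (vandermonde n) y (last k)` detects whether the points
`(n j, y j)` lie on the graph of a polynomial of degree less than `k`. -/
theorem one_le_abs_cramer_vandermonde_last {k : ℕ} {n : Fin (k + 1) → ℤ}
    (hn : Function.Injective n) (y : Fin (k + 1) → ℤ)
    (hnotpoly : ¬ ∃ P : Polynomial ℝ, P.degree < (k : WithBot ℕ) ∧
      ∀ j, P.eval (n j : ℝ) = y j) :
    1 ≤ |Matrix.cramer (Matrix.vandermonde fun j => (n j : ℝ)) (fun j => (y j : ℝ))
      (Fin.last k)| := by
  have hv : Function.Injective fun j => (n j : ℝ) := Int.cast_injective.comp hn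
  have hcast : Matrix.cramer (Matrix.vandermonde fun j => (n j : ℝ)) (fun j => (y j : ℝ))
      (Fin.last k) = (Matrix.cramer (Matrix.vandermonde n) y (Fin.last k) : ℤ) := by
    simp [Matrix.cramer_vandermonde_last, Matrix.det_vandermonde]
  rw [hcast, ← Int.cast_abs]
  norm_cast
  refine Int.one_le_abs fun h0 => hnotpoly ?_
  obtain ⟨P, hPle, hPeval⟩ := exists_natDegree_le_forall_eval_eq hv fun j => (y j : ℝ)
  refine ⟨P, ?_, hPeval⟩
  have hdet := Matrix.cramer_vandermonde_eval_last (fun j => (n j : ℝ)) hPle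
  simp only [hPeval] at hdet
  rw [hcast, h0, Int.cast_zero, eq_comm, mul_eq_zero,
    or_iff_right (Matrix.det_vandermonde_ne_zero_iff.2 hv)] at hdet
  refine lt_of_le_of_ne (Polynomial.natDegree_le_iff_degree_le.1 hPle) fun hdeg => ?_
  exact Polynomial.coeff_ne_zero_of_eq_degree hdeg hdet

theorem abs_cramer_vandermonde_last_le_of_abs_le {k : ℕ} {v b : Fin (k + 1) → ℝ} {L δ : ℝ}
    (hv : ∀ i j, |v i - v j| ≤ L) (hb : ∀ j, |b j| ≤ δ) :
    |Matrix.cramer (Matrix.vandermonde v) b (Fin.last k)| ≤ (k + 1) * (δ * L ^ (k.choose 2)) := by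
  rw [Matrix.cramer_vandermonde_last]
  refine (Finset.abs_sum_le_sum_abs _ _).trans ?_
  have hterm : ∀ j ∈ (Finset.univ : Finset (Fin (k + 1))),
      |(-1) ^ (j + k : ℕ) * b j * (Matrix.vandermonde (v ∘ j.succAbove)).det| ≤
        δ * L ^ (k.choose 2) := by
    intro j _
    rw [abs_mul, abs_mul, abs_pow, abs_neg, abs_one, one_pow, one_mul]
    exact mul_le_mul (hb j) (Matrix.abs_det_vandermonde_le _ fun _ _ => hv _ _)
      (abs_nonneg _) ((abs_nonneg _).trans (hb j))
  simpa using Finset.sum_le_card_nsmul _ _ _ hterm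

theorem abs_cramer_vandermonde_last_le_of_iteratedDerivWithin_le {a b : ℝ} (hab : a < b) {k : ℕ}
    {f : ℝ → ℝ} (hf : ContDiffOn ℝ k f (Set.Icc a b)) {M : ℝ}
    (hM : ∀ x ∈ Set.Icc a b, |iteratedDerivWithin k f (Set.Icc a b) x| ≤ M)
    {v : Fin (k + 1) → ℝ} (hv : StrictMono v) (hmem : ∀ i, v i ∈ Set.Icc a b) {L : ℝ}
    (hL : ∀ i j, |v i - v j| ≤ L) :
    |Matrix.cramer (Matrix.vandermonde v) (fun j => f (v j)) (Fin.last k)| * k.factorial ≤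
      L ^ ((k + 1).choose 2) * M := by
  obtain ⟨P, hPle, hPeval⟩ := exists_natDegree_le_forall_eval_eq hv.injective
    fun j => f (v j)
  obtain ⟨ξ, hξ, hξP⟩ :=
    exists_iteratedDerivWithin_eq_factorial_mul_coeff hab hf hv hmem hPle hPeval
  have hdet := Matrix.cramer_vandermonde_eval_last v hPle
  simp only [hPeval] at hdet
  have hcoeff : |P.coeff k| * k.factorial ≤ M := by
    have := hM ξ hξ
    rwa [hξP, abs_mul, Nat.abs_cast, mul_comm] at this
  rw [hdet, abs_mul, mul_assoc]
  have hL0 : 0 ≤ L := (abs_nonneg _).trans (hL 0 0)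
  exact mul_le_mul (Matrix.abs_det_vandermonde_le v hL) hcoeff (by positivity) (by positivity)


theorem stmt_15 (k N : ℕ) (hk : 3 ≤ k) (hN : 4 ≤ N)
    (δ : ℝ) (hδ0 : 0 < δ) (hδ1 : δ < 1/4)
    (f : ℝ → ℝ) (lam c : ℝ) (hlam : 0 < lam) (hc : 1 ≤ c)
    (hf : ContDiffOn ℝ k f (Set.Icc (N:ℝ) (2*N)))
    (hder : ∀ x ∈ Set.Icc (N:ℝ) (2*N),
      lam ≤ |iteratedDerivWithin k f (Set.Icc (N:ℝ) (2*N)) x| ∧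
      |iteratedDerivWithin k f (Set.Icc (N:ℝ) (2*N)) x| ≤ c * lam)
    (n : Fin (k+1) → ℤ) (hmono : StrictMono n)
    (hlow : (N:ℤ) ≤ n 0) (hhigh : n (Fin.last k) ≤ 2*N)
    (hmem : ∀ j, |f (n j) - round (f (n j))| < δ)
    (hnotpoly : ¬ ∃ P : Polynomial ℝ, P.degree < (k : WithBot ℕ) ∧
      ∀ j, P.eval ((n j : ℤ) : ℝ) = (round (f (n j)) : ℝ)) :
    ((n (Fin.last k) - n 0 : ℤ) : ℝ) >
      min ((c * lam) ^ (-((2:ℝ)/((k:ℝ)*((k:ℝ)+1)))))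
          ((1/2) * δ ^ (-((2:ℝ)/((k:ℝ)*((k:ℝ)-1))))) := by

  by_contra! hle
  obtain ⟨hle₁, hle₂⟩ := le_min_iff.1 hle
  set L : ℝ := ((n (Fin.last k) - n 0 : ℤ) : ℝ) with hLdef
  have hk' : (3 : ℝ) ≤ k := by exact_mod_cast hk
  have hNN : (N : ℝ) < 2 * N := by
    have : (4 : ℝ) ≤ N := by exact_mod_cast hN
    linarith
  have hv : StrictMono fun j => (n j : ℝ) := Int.cast_strictMono.comp hmono
  have hbound : ∀ j, n 0 ≤ n j ∧ n j ≤ n (Fin.last k) := fun j =>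
    ⟨hmono.monotone (Fin.zero_le j), hmono.monotone (Fin.le_last j)⟩
  have hmemI : ∀ j, (n j : ℝ) ∈ Set.Icc (N : ℝ) (2 * N) := fun j =>
    ⟨by exact_mod_cast hlow.trans (hbound j).1, by exact_mod_cast (hbound j).2.trans hhigh⟩
  have hdiff : ∀ i j, |(n i : ℝ) - n j| ≤ L := by
    intro i j
    have : |n i - n j| ≤ n (Fin.last k) - n 0 := by
      have := hbound i
      have := hbound j
      rw [abs_le]
      omega
    rw [hLdef]
    exact_mod_cast this
  have hL0 : 0 ≤ L := (abs_nonneg _).trans (hdiff 0 0)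
  have hM0 : 0 < c * lam := by positivity
  have hmain : L ^ ((k + 1).choose 2) ≤ (c * lam)⁻¹ := by
    refine pow_le_inv_of_le_rpow_neg hL0 hM0 ?_ hle₁
    rw [Nat.cast_choose_two]
    push_cast
    field_simp
    ring
  have herror : (2 * L) ^ (k.choose 2) ≤ δ⁻¹ := by
    refine pow_le_inv_of_le_rpow_neg (by positivity) hδ0 ?_
      (by linarith : 2 * L ≤ δ ^ (-((2 : ℝ) / ((k : ℝ) * ((k : ℝ) - 1)))))
    rw [Nat.cast_choose_two]
    have : (k : ℝ) - 1 ≠ 0 := by linarith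
    field_simp
  have hf_le := abs_cramer_vandermonde_last_le_of_iteratedDerivWithin_le hNN hf
    (fun x hx => (hder x hx).2) hv hmemI hdiff
  have hε_le := abs_cramer_vandermonde_last_le_of_abs_le (v := fun j => (n j : ℝ))
    (b := fun j => f (n j) - round (f (n j))) hdiff fun j => (hmem j).le
  have hy_ge := one_le_abs_cramer_vandermonde_last hmono.injective
    (fun j => round (f (n j))) hnotpoly
  have hsplit : (fun j => (round (f (n j)) : ℝ)) =
      (fun j => f (n j)) - fun j => f (n j) - round (f (n j)) := by
    ext j
    simp
  rw [hsplit, map_sub, Pi.sub_apply] at hy_ge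
  have htri := hy_ge.trans (abs_sub _ _)
  have hfact : (6 : ℝ) ≤ k.factorial := by exact_mod_cast Nat.factorial_le hk
  have hf_le' : |Matrix.cramer (Matrix.vandermonde fun j => (n j : ℝ)) (fun j => f (n j))
      (Fin.last k)| * 6 ≤ 1 := by
    calc _ ≤ _ := mul_le_mul_of_nonneg_left hfact (abs_nonneg _)
      _ ≤ _ := hf_le
      _ ≤ (c * lam)⁻¹ * (c * lam) := mul_le_mul_of_nonneg_right hmain hM0.le
      _ = 1 := inv_mul_cancel₀ hM0.ne'
  have hε_le' : 2 * ((k + 1) * (δ * L ^ (k.choose 2))) ≤ 1 := by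
    have hpow : 2 * ((k : ℝ) + 1) ≤ 2 ^ (k.choose 2) := by
      exact_mod_cast two_mul_succ_le_two_pow_choose_two hk
    calc 2 * ((k + 1) * (δ * L ^ (k.choose 2))) = 2 * ((k : ℝ) + 1) * (δ * L ^ (k.choose 2)) := by
          ring
      _ ≤ 2 ^ (k.choose 2) * (δ * L ^ (k.choose 2)) := by gcongr
      _ = δ * (2 * L) ^ (k.choose 2) := by rw [mul_pow]; ring
      _ ≤ δ * δ⁻¹ := by gcongr
      _ = 1 := mul_inv_cancel₀ hδ0.ne'
  linarith
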